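/- Let G be a strongly connected digraph, let (x,y) be a strong bridge of G, let C be a strongly connected component of G \ (x,y), and let C' be the corresponding digraph in S(G,(x,y)). Let u and v be vertices of C and let e be an edge of C' with both endpoints in C. Then u reaches v in C' \ e if and only if u reaches v in G \ e. -/

import Mathlib

/-- A directed multigraph: a type `E` of potential edges with source and target
maps, together with the set of edges actually present in the digraph. -/
structure MultiDigraph (V : Type) (E : Type) where
  edges : Set E
  src : E → V
  tgt : E → V

namespace MultiDigraph

variable {V E : Type}

/-- `G.IsWalk u v l` : the list of edges `l` forms a walk from `u` to `v`
(consecutive edges compose). -/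
def IsWalk (G : MultiDigraph V E) : V → V → List E → Prop
  | u, v, [] => u = v
  | u, v, e :: l => e ∈ G.edges ∧ G.src e = u ∧ G.IsWalk (G.tgt e) v l

/-- A path from `u` to `v`: a walk using no edge more than once. -/
def IsTrail (G : MultiDigraph V E) (u v : V) (l : List E) : Prop :=
  G.IsWalk u v l ∧ l.Nodup

/-- `u` reaches `v`: there is a path from `u` to `v`. -/
def Reaches (G : MultiDigraph V E) (u v : V) : Prop :=
  ∃ l : List E, G.IsTrail u v l

/-- `u` and `v` are strongly connected: each reaches the other. -/
def SConn (G : MultiDigraph V E) (u v : V) : Prop :=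
  G.Reaches u v ∧ G.Reaches v u

/-- The digraph is strongly connected. -/
def StronglyConnected (G : MultiDigraph V E) : Prop :=
  ∀ u v : V, G.Reaches u v

/-- Delete the edge `e`. -/
def deleteEdge (G : MultiDigraph V E) (e : E) : MultiDigraph V E :=
  { G with edges := G.edges \ {e} }

/-- A strong bridge: an edge whose deletion destroys strong connectivity. -/
def IsStrongBridge (G : MultiDigraph V E) (e : E) : Prop :=
  e ∈ G.edges ∧ ¬ (G.deleteEdge e).StronglyConnected

end MultiDigraph

namespace MultiDigraph

variable {V E : Type}

/-- `C` is a strongly connected component of `G` (as a set of vertices):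
the equivalence class of some vertex under mutual reachability. -/
def IsSCC (G : MultiDigraph V E) (C : Set V) : Prop :=
  ∃ c : V, C = {w | G.SConn c w}

/-- The digraph `C'` of `S(G,(x,y))` corresponding to the strongly connected
component `C` of `G \ (x,y)`, where `(x,y)` is the strong bridge `e₀`:
it keeps every edge of `G` with both endpoints in `C`, adds one edge `(u,x)`
for every edge `(u,v)` of `G` with `u ∈ C`, `v ∉ C`, one edge `(y,v)` for every
edge `(u,v)` of `G` with `u ∉ C`, `v ∈ C`, and the extra edge `(x,y)`
(represented by `Sum.inr ()`). -/
noncomputable def sOp (G : MultiDigraph V E) (e₀ : E) (C : Set V) :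
    MultiDigraph V (E ⊕ Unit) := by
  classical
  exact
    { edges := Sum.inl '' {e | e ∈ G.edges ∧ (G.src e ∈ C ∨ G.tgt e ∈ C)} ∪
        {Sum.inr ()}
      src := fun p =>
        match p with
        | Sum.inl e => if G.src e ∈ C then G.src e else G.tgt e₀
        | Sum.inr _ => G.src e₀
      tgt := fun p =>
        match p with
        | Sum.inl e => if G.tgt e ∈ C then G.tgt e else G.src e₀
        | Sum.inr _ => G.tgt e₀ }

/-- The digraph `G` is strongly connected when regarded as a digraph with
vertex set `W` : every vertex of `W` reaches every other vertex of `W`. -/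
def SCOn (G : MultiDigraph V E) (W : Set V) : Prop :=
  ∀ a ∈ W, ∀ b ∈ W, G.Reaches a b

end MultiDigraph

namespace MultiDigraph

variable {V E : Type}

/-- Some edge of `G` goes from `a` to `b`. -/
def Step (G : MultiDigraph V E) (a b : V) : Prop :=
  ∃ f ∈ G.edges, G.src f = a ∧ G.tgt f = b

theorem IsTrail.exists_from_src {G : MultiDigraph V E} {f : E} :
    ∀ {u v : V} {l : List E}, G.IsTrail u v l → f ∈ l → ∃ l', G.IsTrail (G.src f) v l'
  | _, _, [], _, hf => by simp at hf
  | _, _, g :: l, ⟨⟨hg, hgu, hw⟩, hn⟩, hf => by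
    rcases List.mem_cons.1 hf with rfl | hf
    · exact ⟨_ :: l, ⟨hg, rfl, hw⟩, hn⟩
    · exact IsTrail.exists_from_src ⟨hw, (List.nodup_cons.1 hn).2⟩ hf

theorem IsWalk.reflTransGen {G : MultiDigraph V E} :
    ∀ {u v : V} {l : List E}, G.IsWalk u v l → Relation.ReflTransGen G.Step u v
  | _, _, [], h => by
    cases h
    exact .refl
  | _, _, g :: _, ⟨hg, hgu, hw⟩ => .head ⟨g, hg, hgu, rfl⟩ hw.reflTransGen

theorem reaches_iff_reflTransGen {G : MultiDigraph V E} {u v : V} :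
    G.Reaches u v ↔ Relation.ReflTransGen G.Step u v := by
  refine ⟨fun ⟨l, h⟩ => h.1.reflTransGen, fun h => ?_⟩
  induction h using Relation.ReflTransGen.head_induction_on with
  | refl => exact ⟨[], rfl, List.nodup_nil⟩
  | head hs _ ih =>
    obtain ⟨f, hf, rfl, rfl⟩ := hs
    obtain ⟨l, hl⟩ := ih
    by_cases hfl : f ∈ l
    · exact hl.exists_from_src hfl
    · exact ⟨f :: l, ⟨hf, rfl, hl.1⟩, List.nodup_cons.2 ⟨hfl, hl.2⟩⟩

theorem Reaches.refl (G : MultiDigraph V E) (u : V) : G.Reaches u u :=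
  ⟨[], rfl, List.nodup_nil⟩

theorem Reaches.trans {G : MultiDigraph V E} {u v w : V} (h : G.Reaches u v)
    (h' : G.Reaches v w) : G.Reaches u w := by
  rw [reaches_iff_reflTransGen] at *
  exact h.trans h'

theorem Reaches.of_edge {G : MultiDigraph V E} {f : E} (hf : f ∈ G.edges) :
    G.Reaches (G.src f) (G.tgt f) :=
  reaches_iff_reflTransGen.2 (.single ⟨f, hf, rfl, rfl⟩)

@[elab_as_elim]
theorem Reaches.head_induction {G : MultiDigraph V E} {v : V}
    {P : ∀ u, G.Reaches u v → Prop} {u : V} (h : G.Reaches u v) (refl : P v (.refl G v))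
    (head : ∀ f (hf : f ∈ G.edges) (h : G.Reaches (G.tgt f) v),
      P (G.tgt f) h → P (G.src f) ((Reaches.of_edge hf).trans h)) : P u h := by
  have h' := reaches_iff_reflTransGen.1 h
  induction h' using Relation.ReflTransGen.head_induction_on with
  | refl => exact refl
  | head hs h' ih =>
    obtain ⟨f, hf, rfl, rfl⟩ := hs
    exact head f hf (reaches_iff_reflTransGen.2 h') (ih _)

theorem Reaches.of_edge_deleteEdge {G : MultiDigraph V E} {e f : E} (hf : f ∈ G.edges)
    (hfe : f ≠ e) : (G.deleteEdge e).Reaches (G.src f) (G.tgt f) :=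
  Reaches.of_edge (G := G.deleteEdge e) ⟨hf, hfe⟩

theorem Reaches.deleteEdge_src {G : MultiDigraph V E} {e₀ : E} {a : V}
    (h : G.Reaches a (G.src e₀)) : (G.deleteEdge e₀).Reaches a (G.src e₀) := by
  induction h using Reaches.head_induction with
  | refl => exact .refl _ _
  | head f hf _ ih =>
    by_cases hfe : f = e₀
    · subst hfe; exact .refl _ _
    · exact (Reaches.of_edge_deleteEdge hf hfe).trans ih

/-- If `a` reaches `b`, then some path to `b` avoiding `e₀` starts at `a` or at the target
of `e₀`. -/
theorem Reaches.deleteEdge_or {G : MultiDigraph V E} {e₀ : E} {a b : V}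
    (h : G.Reaches a b) :
    (G.deleteEdge e₀).Reaches a b ∨ (G.deleteEdge e₀).Reaches (G.tgt e₀) b := by
  induction h using Reaches.head_induction with
  | refl => exact .inl (.refl _ _)
  | head f hf _ ih =>
    rcases ih with ih | ih
    · by_cases hfe : f = e₀
      · subst hfe; exact .inr ih
      · exact .inl ((Reaches.of_edge_deleteEdge hf hfe).trans ih)
    · exact .inr ih

theorem Reaches.deleteEdge_tgt {G : MultiDigraph V E} {e₀ : E} {b : V}
    (h : G.Reaches (G.tgt e₀) b) : (G.deleteEdge e₀).Reaches (G.tgt e₀) b :=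
  h.deleteEdge_or.elim id id

/-- A path of `G \ e₀` that cannot be routed through `e` survives in `G \ e`. -/
theorem Reaches.deleteEdge_of_not {G : MultiDigraph V E} {e₀ e : E} {a b : V}
    (h : (G.deleteEdge e₀).Reaches a b)
    (hn : ¬ ((G.deleteEdge e₀).Reaches a (G.src e) ∧ (G.deleteEdge e₀).Reaches (G.tgt e) b)) :
    (G.deleteEdge e).Reaches a b := by
  induction h using Reaches.head_induction with
  | refl => exact .refl _ _
  | head f hf h ih =>
    have hfe : f ≠ e := by
      rintro rfl
      exact hn ⟨.refl _ _, h⟩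
    exact (Reaches.of_edge_deleteEdge hf.1 hfe).trans
      (ih fun h' => hn ⟨(Reaches.of_edge hf).trans h'.1, h'.2⟩)

theorem IsSCC.reaches {G : MultiDigraph V E} {C : Set V} (hC : G.IsSCC C) {p q : V}
    (hp : p ∈ C) (hq : q ∈ C) : G.Reaches p q := by
  obtain ⟨c, rfl⟩ := hC
  exact hp.2.trans hq.1

theorem IsSCC.mem_of_reaches {G : MultiDigraph V E} {C : Set V} (hC : G.IsSCC C) {p q r : V}
    (hp : p ∈ C) (hr : r ∈ C) (hpq : G.Reaches p q) (hqr : G.Reaches q r) : q ∈ C := by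
  obtain ⟨c, rfl⟩ := hC
  exact ⟨hp.1.trans hpq, hqr.trans hr.2⟩

theorem IsStrongBridge.not_reaches {G : MultiDigraph V E} {e₀ : E} (hbr : G.IsStrongBridge e₀)
    (hG : G.StronglyConnected) : ¬ (G.deleteEdge e₀).Reaches (G.src e₀) (G.tgt e₀) :=
  fun h => hbr.2 fun a b =>
    ((hG a _).deleteEdge_src.trans h).trans (hG _ b).deleteEdge_tgt

/-- An edge leaving the component `C` of `G \ e₀` extends, avoiding any edge `e` inside `C`,
to a path to the source of `e₀`. -/
theorem IsSCC.reaches_src_of_leaving {G : MultiDigraph V E} (hG : G.StronglyConnected)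
    {e₀ e f : E} {C : Set V} (hC : (G.deleteEdge e₀).IsSCC C) (hs : G.src e ∈ C)
    (ht : G.tgt e ∈ C) (hf : f ∈ G.edges) (hfs : G.src f ∈ C) (hft : G.tgt f ∉ C) :
    (G.deleteEdge e).Reaches (G.src f) (G.src e₀) := by
  by_cases hf₀ : f = e₀
  · subst hf₀; exact .refl _ _
  refine (Reaches.of_edge_deleteEdge hf fun h => hft (h ▸ ht)).trans
    ((hG _ _).deleteEdge_src.deleteEdge_of_not fun h => hft ?_)
  exact hC.mem_of_reaches hfs hs (Reaches.of_edge_deleteEdge hf hf₀) h.1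

/-- An edge entering the component `C` of `G \ e₀` extends, avoiding any edge `e` inside `C`,
to a path from the target of `e₀`. -/
theorem IsSCC.reaches_of_entering {G : MultiDigraph V E} (hG : G.StronglyConnected)
    {e₀ e f : E} {C : Set V} (hC : (G.deleteEdge e₀).IsSCC C) (hs : G.src e ∈ C)
    (ht : G.tgt e ∈ C) (hf : f ∈ G.edges) (hfs : G.src f ∉ C) (hft : G.tgt f ∈ C) :
    (G.deleteEdge e).Reaches (G.tgt e₀) (G.tgt f) := by
  by_cases hf₀ : f = e₀
  · subst hf₀; exact .refl _ _
  refine ((hG _ _).deleteEdge_tgt.deleteEdge_of_not fun h => hfs ?_).trans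
    (Reaches.of_edge_deleteEdge hf fun h => hfs (h ▸ hs))
  exact hC.mem_of_reaches ht hft h.2 (Reaches.of_edge_deleteEdge hf hf₀)

theorem sOp_src_inl_of_mem {G : MultiDigraph V E} {e₀ f : E} {C : Set V} (h : G.src f ∈ C) :
    (G.sOp e₀ C).src (.inl f) = G.src f := if_pos h

theorem sOp_src_inl_of_notMem {G : MultiDigraph V E} {e₀ f : E} {C : Set V}
    (h : G.src f ∉ C) : (G.sOp e₀ C).src (.inl f) = G.tgt e₀ := if_neg h

theorem sOp_tgt_inl_of_mem {G : MultiDigraph V E} {e₀ f : E} {C : Set V} (h : G.tgt f ∈ C) :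
    (G.sOp e₀ C).tgt (.inl f) = G.tgt f := if_pos h

theorem sOp_tgt_inl_of_notMem {G : MultiDigraph V E} {e₀ f : E} {C : Set V}
    (h : G.tgt f ∉ C) : (G.sOp e₀ C).tgt (.inl f) = G.src e₀ := if_neg h

theorem inl_mem_sOp_edges {G : MultiDigraph V E} {e₀ f : E} {C : Set V} :
    Sum.inl f ∈ (G.sOp e₀ C).edges ↔ f ∈ G.edges ∧ (G.src f ∈ C ∨ G.tgt f ∈ C) := by
  simp [sOp, and_or_left]

theorem inr_mem_sOp_edges {G : MultiDigraph V E} {e₀ : E} {C : Set V} :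
    Sum.inr () ∈ (G.sOp e₀ C).edges := by
  simp [sOp]

theorem reaches_of_reaches_sOp {G : MultiDigraph V E} (hG : G.StronglyConnected)
    {e₀ e : E} (hbr : G.IsStrongBridge e₀) {C : Set V} (hC : (G.deleteEdge e₀).IsSCC C)
    (hs : G.src e ∈ C) (ht : G.tgt e ∈ C) {u v : V}
    (h : ((G.sOp e₀ C).deleteEdge (Sum.inl e)).Reaches u v) :
    (G.deleteEdge e).Reaches u v := by
  induction h using Reaches.head_induction with
  | refl => exact .refl _ _
  | head f hf _ ih =>
    refine Reaches.trans ?_ ih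
    change (G.deleteEdge e).Reaches ((G.sOp e₀ C).src f) ((G.sOp e₀ C).tgt f)
    obtain ⟨hf, hfe⟩ := hf
    rcases f with f | ⟨⟩
    · obtain ⟨hf, hfC⟩ := inl_mem_sOp_edges.1 hf
      by_cases hfs : G.src f ∈ C <;> by_cases hft : G.tgt f ∈ C
      · rw [sOp_src_inl_of_mem hfs, sOp_tgt_inl_of_mem hft]
        exact Reaches.of_edge_deleteEdge hf fun h => hfe (congrArg Sum.inl h)
      · rw [sOp_src_inl_of_mem hfs, sOp_tgt_inl_of_notMem hft]
        exact hC.reaches_src_of_leaving hG hs ht hf hfs hft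
      · rw [sOp_src_inl_of_notMem hfs, sOp_tgt_inl_of_mem hft]
        exact hC.reaches_of_entering hG hs ht hf hfs hft
      · exact absurd hfC (not_or.2 ⟨hfs, hft⟩)
    · refine Reaches.of_edge_deleteEdge hbr.1 ?_
      rintro rfl
      exact hbr.not_reaches hG (hC.reaches hs ht)

open Classical in
theorem reaches_sOp_of_reaches {G : MultiDigraph V E} {e₀ e : E} {C : Set V}
    {u v : V} (hv : v ∈ C)
    (h : (G.deleteEdge e).Reaches u v) :
    ((G.sOp e₀ C).deleteEdge (Sum.inl e)).Reaches (if u ∈ C then u else G.tgt e₀) v := by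
  induction h using Reaches.head_induction with
  | refl =>
    rw [if_pos hv]
    exact .refl _ _
  | head f hf _ ih =>
    obtain ⟨hf, hfe⟩ := hf
    change ((G.sOp e₀ C).deleteEdge (Sum.inl e)).Reaches
      (if G.src f ∈ C then G.src f else G.tgt e₀) v
    change ((G.sOp e₀ C).deleteEdge (Sum.inl e)).Reaches
      (if G.tgt f ∈ C then G.tgt f else G.tgt e₀) v at ih
    have edge (hfC : G.src f ∈ C ∨ G.tgt f ∈ C) :=
      Reaches.of_edge_deleteEdge (inl_mem_sOp_edges (e₀ := e₀).2 ⟨hf, hfC⟩)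
        fun h => hfe (Sum.inl_injective h)
    by_cases hfs : G.src f ∈ C <;> by_cases hft : G.tgt f ∈ C <;>
      simp only [hfs, hft, if_true, if_false] at ih ⊢
    · have := edge (.inl hfs)
      rw [sOp_src_inl_of_mem hfs, sOp_tgt_inl_of_mem hft] at this
      exact this.trans ih
    · have := edge (.inl hfs)
      rw [sOp_src_inl_of_mem hfs, sOp_tgt_inl_of_notMem hft] at this
      exact (this.trans (Reaches.of_edge_deleteEdge inr_mem_sOp_edges Sum.inr_ne_inl)).trans ih
    · have := edge (.inr hft)
      rw [sOp_src_inl_of_notMem hfs, sOp_tgt_inl_of_mem hft] at this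
      exact this.trans ih
    · exact ih

end MultiDigraph

/-- Let `e₀ = (x,y)` be a strong bridge of the strongly
connected digraph `G`, let `C` be a strongly connected component of `G \ e₀`
and `C'` the corresponding digraph of `S(G,e₀)`. For vertices `u`, `v` of `C`
and an edge `e` of `C'` with both endpoints in `C`: `u` reaches `v` in
`C' \ e` iff `u` reaches `v` in `G \ e`. -/
theorem statement_14 {V E : Type} (G : MultiDigraph V E)
    (hG : G.StronglyConnected) (e₀ : E) (hbr : G.IsStrongBridge e₀)
    (C : Set V) (hC : (G.deleteEdge e₀).IsSCC C)
    (u v : V) (hu : u ∈ C) (hv : v ∈ C)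
    (e : E) (he : e ∈ G.edges) (hs : G.src e ∈ C) (ht : G.tgt e ∈ C) :
    ((G.sOp e₀ C).deleteEdge (Sum.inl e)).Reaches u v ↔
      (G.deleteEdge e).Reaches u v := by
  refine ⟨MultiDigraph.reaches_of_reaches_sOp hG hbr hC hs ht, fun h => ?_⟩
  simpa only [if_pos hu] using MultiDigraph.reaches_sOp_of_reaches (e₀ := e₀) hv h
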